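/- Let N≥2, 1<q≤1*=N/(N−1) and M>0. There exists a constant C=C(N,q,M) such that for every u∈BV̇(R^N)∩L^1(R^N) with |u|≤M almost everywhere, ‖u‖_{L^{1*,q}(R^N)}^q ≤ C (‖Du‖ + ‖u‖_{L^1(R^N)}) (sup_{y∈Z^N} ∫_{y+(0,1)^N} |u(x)| dx)^{(q−1)/3}. -/

import Mathlib

open MeasureTheory Set Filter Topology ENNReal

noncomputable section

abbrev Euc (N : ℕ) := EuclideanSpace ℝ (Fin N)

/-- Decreasing rearrangement of `u` with respect to Lebesgue measure on `ℝ^N`. -/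
def rearr (N : ℕ) (u : Euc N → ℝ) (t : ℝ) : ℝ :=
  sInf {l : ℝ | 0 < l ∧ volume {x : Euc N | l < |u x|} ≤ ENNReal.ofReal t}

/-- Lorentz quasinorm `‖u‖_{L^{p,q}}` on `ℝ^N` (with `q = ∞` allowed). -/
def lorentz (N : ℕ) (p : ℝ) (q : ℝ≥0∞) (u : Euc N → ℝ) : ℝ≥0∞ :=
  if q = ∞ then ⨆ t ∈ Ioi (0:ℝ), ENNReal.ofReal (t ^ (1/p) * rearr N u t)
  else (∫⁻ t in Ioi (0:ℝ),
      ENNReal.ofReal ((t ^ (1/p) * rearr N u t) ^ q.toReal / t)) ^ (1 / q.toReal)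

/-- Divergence of a vector field on `ℝ^N`. -/
def divg (N : ℕ) (v : Euc N → Euc N) (x : Euc N) : ℝ :=
  ∑ i : Fin N, fderiv ℝ v x (EuclideanSpace.single i 1) i

/-- Total variation `‖Du‖_Ω` of `u` over a set `Ω`. -/
def TV (N : ℕ) (u : Euc N → ℝ) (Ω : Set (Euc N)) : ℝ≥0∞ :=
  ⨆ (v : Euc N → Euc N) (_ : ContDiff ℝ (⊤ : ℕ∞) v) (_ : HasCompactSupport v)
    (_ : ∀ x, ‖v x‖ ≤ 1) (_ : tsupport v ⊆ Ω),
    ENNReal.ofReal (∫ x, u x * divg N v x)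

/-- `u` vanishes at infinity. -/
def VanishAtInfinity (N : ℕ) (u : Euc N → ℝ) : Prop :=
  ∀ M : ℝ, 0 < M → volume {x : Euc N | M < |u x|} < ∞

/-- Membership in `BV̇(ℝ^N)`. -/
def MemBVdot (N : ℕ) (u : Euc N → ℝ) : Prop :=
  Measurable u ∧ VanishAtInfinity N u ∧ TV N u univ < ∞

/-- The rescaling `g[j,y]u = 2^{(N-1)j} u (2^j (· - y))`. -/
def resc (N : ℕ) (j : ℤ) (y : Euc N) (u : Euc N → ℝ) : Euc N → ℝ :=
  fun x => (2:ℝ) ^ (((N:ℤ) - 1) * j) * u ((2:ℝ) ^ j • (x - y))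

/-- Weak convergence `u k ⇀ w` in `BV̇(ℝ^N)`. -/
def WeakBVconv (N : ℕ) (u : ℕ → Euc N → ℝ) (w : Euc N → ℝ) : Prop :=
  (∀ K : Set (Euc N), IsCompact K →
      Tendsto (fun k => ∫ x in K, |u k x - w x|) atTop (𝓝 0)) ∧
  ∀ i : Fin N, ∀ f : Euc N → ℝ, ContDiff ℝ (⊤ : ℕ∞) f → HasCompactSupport f →
      Tendsto (fun k => ∫ x, u k x * fderiv ℝ f x (EuclideanSpace.single i 1)) atTop
        (𝓝 (∫ x, w x * fderiv ℝ f x (EuclideanSpace.single i 1)))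

/-- The translated open unit cube `y + (0,1)^N`, `y ∈ ℤ^N`. -/
def cubeAt (N : ℕ) (y : Fin N → ℤ) : Set (Euc N) :=
  {x : Euc N | ∀ i : Fin N, x i - (y i : ℝ) ∈ Ioo (0:ℝ) 1}

theorem rearr_nonneg (N : ℕ) (u : Euc N → ℝ) (t : ℝ) : 0 ≤ rearr N u t :=
  Real.sInf_nonneg fun _ hl => hl.1.le

theorem rearr_le (N : ℕ) (u : Euc N → ℝ) {t l : ℝ} (hl : 0 < l)
    (h : volume {x : Euc N | l < |u x|} ≤ ENNReal.ofReal t) : rearr N u t ≤ l :=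
  csInf_le ⟨0, fun _ hl => hl.1.le⟩ ⟨hl, h⟩

/-- A rearrangement bounded by `M` near `0` and by a sufficiently fast decaying power at infinity
has a controlled Lorentz integral. -/
theorem lintegral_lorentz_le {f : ℝ → ℝ} {p q r K M : ℝ} (hp : 0 < p) (hq : 0 < q) (hr : 0 < r)
    (hrq : r < q) (hK : 0 < K) (hM : 0 < M) (hf0 : ∀ t, 0 ≤ f t) (hfM : ∀ t, 0 < t → f t ≤ M)
    (hf : ∀ t, 0 < t → f t ≤ (K * t ^ (-(q / p))) ^ (1 / r)) :
    ∫⁻ t in Ioi (0 : ℝ), ENNReal.ofReal ((t ^ (1 / p) * f t) ^ q / t) ≤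
      ENNReal.ofReal ((M ^ q / (q / p) + 1 / (q / p * (q / r - 1))) * K) := by
  set a := q / p with ha
  set s := q / r with hs
  have ha0 : 0 < a := by positivity
  have hs1 : 1 < s := (one_lt_div hr).2 hrq
  set t₀ := K ^ (1 / a) with ht₀
  have ht₀0 : 0 < t₀ := by positivity
  have hsplit : ∀ t, 0 < t → (t ^ (1 / p) * f t) ^ q / t = t ^ (a - 1) * f t ^ q := by
    intro t ht
    rw [Real.mul_rpow (by positivity) (hf0 t), ← Real.rpow_mul ht.le, Real.rpow_sub_one ht.ne', ha]
    rw [show 1 / p * q = q / p by ring]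
    ring
  have hnear : ∫⁻ t in Ioc 0 t₀, ENNReal.ofReal ((t ^ (1 / p) * f t) ^ q / t) ≤
      ENNReal.ofReal (M ^ q / a * K) := by
    have hint : IntegrableOn (fun t : ℝ => t ^ (a - 1) * M ^ q) (Ioc 0 t₀) := by
      rw [← intervalIntegrable_iff_integrableOn_Ioc_of_le ht₀0.le]
      exact (intervalIntegral.intervalIntegrable_rpow' (by linarith)).mul_const _
    calc _ ≤ ∫⁻ t in Ioc 0 t₀, ENNReal.ofReal (t ^ (a - 1) * M ^ q) := by
          refine setLIntegral_mono' measurableSet_Ioc fun t ht => ENNReal.ofReal_le_ofReal ?_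
          rw [hsplit t ht.1]
          have := Real.rpow_le_rpow (hf0 t) (hfM t ht.1) hq.le
          have := ht.1
          gcongr
      _ = ENNReal.ofReal (∫ t in Ioc 0 t₀, t ^ (a - 1) * M ^ q) := by
          rw [ofReal_integral_eq_lintegral_ofReal hint]
          filter_upwards [ae_restrict_mem measurableSet_Ioc] with t ht
          have := ht.1
          simp only [Pi.zero_apply]
          positivity
      _ = _ := by
          congr 1
          rw [integral_mul_const, ← intervalIntegral.integral_of_le ht₀0.le,
            integral_rpow (Or.inl (by linarith)), sub_add_cancel, Real.zero_rpow ha0.ne', ht₀,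
            ← Real.rpow_mul hK.le, one_div_mul_cancel ha0.ne', Real.rpow_one]
          ring
  have hfar : ∫⁻ t in Ioi t₀, ENNReal.ofReal ((t ^ (1 / p) * f t) ^ q / t) ≤
      ENNReal.ofReal (1 / (a * (s - 1)) * K) := by
    have hexp : a - 1 - a * s < -1 := by nlinarith
    have hint : IntegrableOn (fun t : ℝ => K ^ s * t ^ (a - 1 - a * s)) (Ioi t₀) :=
      (integrableOn_Ioi_rpow_of_lt hexp ht₀0).const_mul _
    calc _ ≤ ∫⁻ t in Ioi t₀, ENNReal.ofReal (K ^ s * t ^ (a - 1 - a * s)) := by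
          refine setLIntegral_mono' measurableSet_Ioi fun t ht => ENNReal.ofReal_le_ofReal ?_
          have ht0 : 0 < t := ht₀0.trans ht
          rw [hsplit t ht0]
          have h1 := Real.rpow_le_rpow (hf0 t) (hf t ht0) hq.le
          rw [← Real.rpow_mul (by positivity), show 1 / r * q = s by rw [hs]; ring,
            Real.mul_rpow hK.le (by positivity), ← Real.rpow_mul ht0.le] at h1
          calc t ^ (a - 1) * f t ^ q ≤ t ^ (a - 1) * (K ^ s * t ^ (-a * s)) := by gcongr
            _ = _ := by
              rw [show a - 1 - a * s = (a - 1) + (-a * s) by ring, Real.rpow_add ht0]; ring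
      _ = ENNReal.ofReal (∫ t in Ioi t₀, K ^ s * t ^ (a - 1 - a * s)) := by
          rw [ofReal_integral_eq_lintegral_ofReal hint]
          filter_upwards [ae_restrict_mem measurableSet_Ioi] with t ht
          have : 0 < t := ht₀0.trans ht
          simp only [Pi.zero_apply]
          positivity
      _ = _ := by
          congr 1
          rw [integral_const_mul, integral_Ioi_rpow_of_lt hexp ht₀0, ht₀, ← Real.rpow_mul hK.le,
            show 1 / a * (a - 1 - a * s + 1) = 1 - s by field_simp; ring,
            Real.rpow_sub hK, Real.rpow_one]
          have : a - 1 - a * s + 1 ≠ 0 := by linarith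
          have : s - 1 ≠ 0 := by linarith
          have : K ^ s ≠ 0 := by positivity
          rw [show a - 1 - a * s + 1 = -(a * (s - 1)) by ring]
          field_simp
  have hs1' : 0 < s - 1 := by linarith
  rw [← Ioc_union_Ioi_eq_Ioi ht₀0.le]
  refine (lintegral_union_le _ _ _).trans ((add_le_add hnear hfar).trans ?_)
  rw [← ENNReal.ofReal_add (by positivity) (by positivity), add_mul]

/-- A power-type bound on the distribution function of a bounded function controls its
Lorentz norm. -/
theorem lorentz_rpow_le {N : ℕ} {u : Euc N → ℝ} {p q r K M : ℝ} (hp : 0 < p) (hq : 0 < q)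
    (hr : 0 < r) (hrq : r < q) (hK : 0 ≤ K) (hM : 0 < M) (huM : ∀ᵐ x, |u x| ≤ M)
    (hd : ∀ l : ℝ, 0 < l →
      volume {x : Euc N | l < |u x|} ^ (q / p) ≤ ENNReal.ofReal (K * l ^ (-r))) :
    lorentz N p (ENNReal.ofReal q) u ^ q ≤
      ENNReal.ofReal ((M ^ q / (q / p) + 1 / (q / p * (q / r - 1))) * K) := by
  have ha0 : 0 < q / p := by positivity
  rw [lorentz, if_neg ENNReal.ofReal_ne_top, ENNReal.toReal_ofReal hq.le, ← ENNReal.rpow_mul,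
    one_div_mul_cancel hq.ne', ENNReal.rpow_one]
  have hfM : ∀ t, 0 < t → rearr N u t ≤ M := fun t _ => by
    refine rearr_le N u hM ?_
    rw [show volume {x : Euc N | M < |u x|} = 0 by simpa [ae_iff] using huM]
    exact zero_le
  have key : ∀ K', K < K' → ∫⁻ t in Ioi (0 : ℝ),
      ENNReal.ofReal ((t ^ (1 / p) * rearr N u t) ^ q / t) ≤
        ENNReal.ofReal ((M ^ q / (q / p) + 1 / (q / p * (q / r - 1))) * K') := by
    intro K' hK'
    have hK'0 : 0 < K' := hK.trans_lt hK'
    refine lintegral_lorentz_le hp hq hr hrq hK'0 hM (rearr_nonneg N u) hfM fun t ht => ?_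
    have hl : 0 < (K' * t ^ (-(q / p))) ^ (1 / r) := by positivity
    refine rearr_le N u hl ?_
    have hval : K' * ((K' * t ^ (-(q / p))) ^ (1 / r)) ^ (-r) = t ^ (q / p) := by
      rw [← Real.rpow_mul (by positivity), show 1 / r * -r = -1 by field_simp, Real.rpow_neg_one,
        Real.rpow_neg ht.le, mul_inv, inv_inv, mul_inv_cancel_left₀ hK'0.ne']
    have h := (hd _ hl).trans (ENNReal.ofReal_le_ofReal
      (mul_le_mul_of_nonneg_right hK'.le (Real.rpow_nonneg hl.le _)))
    rw [hval, ← ENNReal.ofReal_rpow_of_pos ht] at h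
    exact (ENNReal.rpow_le_rpow_iff ha0).1 h
  have hlim : Tendsto (fun K' => ENNReal.ofReal
      ((M ^ q / (q / p) + 1 / (q / p * (q / r - 1))) * K')) (𝓝[>] K)
      (𝓝 (ENNReal.ofReal ((M ^ q / (q / p) + 1 / (q / p * (q / r - 1))) * K))) :=
    ((ENNReal.continuous_ofReal.comp (continuous_const.mul continuous_id)).tendsto K).mono_left
      nhdsWithin_le_nhds
  exact ge_of_tendsto hlim (by filter_upwards [self_mem_nhdsWithin] with K' hK' using key K' hK')

theorem ENNReal_rpow_tsum_le {ι : Type*} (f : ι → ℝ≥0∞) {a : ℝ} (ha0 : 0 < a) (ha1 : a ≤ 1) :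
    (∑' i, f i) ^ a ≤ ∑' i, f i ^ a := by
  have hlim : Tendsto (fun s : Finset ι => (∑ i ∈ s, f i) ^ a) atTop (𝓝 ((∑' i, f i) ^ a)) :=
    ((ENNReal.continuous_rpow_const (y := a)).tendsto _).comp ENNReal.summable.hasSum
  refine le_of_tendsto' hlim fun s => le_trans ?_ (ENNReal.sum_le_tsum s)
  classical
  induction s using Finset.induction_on with
  | empty => simp [ENNReal.zero_rpow_of_pos ha0]
  | insert i s hi ih =>
    rw [Finset.sum_insert hi, Finset.sum_insert hi]
    exact (ENNReal.rpow_add_le_add_rpow _ _ ha0.le ha1).trans (by gcongr)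

theorem volume_setOf_coord_eq (N : ℕ) (i : Fin N) (c : ℝ) :
    volume {x : Euc N | x i = c} = 0 := by
  have h := (PiLp.volume_preserving_ofLp (Fin N)).measure_preimage
    (s := {f : Fin N → ℝ | f i = c})
    (measurableSet_eq_fun (measurable_pi_apply i) measurable_const).nullMeasurableSet
  rw [volume_pi, Measure.pi_hyperplane] at h
  exact h

theorem ae_mem_iUnion_cubeAt (N : ℕ) : ∀ᵐ x : Euc N, ∃ y : Fin N → ℤ, x ∈ cubeAt N y := by
  have h : ∀ᵐ x : Euc N, ∀ (i : Fin N) (c : ℤ), x i ≠ c := by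
    refine ae_all_iff.2 fun i => ae_all_iff.2 fun c => ?_
    simpa [ae_iff] using volume_setOf_coord_eq N i c
  filter_upwards [h] with x hx
  refine ⟨fun i => ⌊x i⌋, fun i => ⟨?_, ?_⟩⟩
  · exact sub_pos.2 (lt_of_le_of_ne (Int.floor_le _) (hx i _).symm)
  · linarith [Int.lt_floor_add_one (x i)]

theorem measurableSet_cubeAt (N : ℕ) (y : Fin N → ℤ) : MeasurableSet (cubeAt N y) := by
  rw [cubeAt, ofPred_forall]
  refine MeasurableSet.iInter fun i => measurableSet_preimage ?_ measurableSet_Ioo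
  fun_prop

/-- Distribution function estimate obtained by summing over unit cubes. -/
theorem volume_rpow_le_of_cubes {N : ℕ} {u : Euc N → ℝ} (hu : Measurable u) {p q : ℝ} (hp : 0 < p)
    (hq1 : 1 < q) (hqp : q ≤ p) {S : ℝ≥0∞}
    (hS : ∀ y, ∫⁻ x in cubeAt N y, ‖u x‖ₑ ≤ S) {l : ℝ} (hl : 0 < l) :
    volume {x : Euc N | l < |u x|} ^ (q / p) ≤ (S / ENNReal.ofReal l) ^ ((q - 1) / p) *
      ((∑' y, (∫⁻ x in cubeAt N y, ‖u x‖ₑ ^ p) ^ (1 / p)) / ENNReal.ofReal l) := by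
  set E := {x : Euc N | l < |u x|}
  have hl' : ENNReal.ofReal l ≠ 0 := by simpa using hl
  have hEsub : ∀ x ∈ E, ENNReal.ofReal l ≤ ‖u x‖ₑ := fun x hx => by
    rw [Real.enorm_eq_ofReal_abs]
    exact ENNReal.ofReal_le_ofReal (le_of_lt hx)
  have hcover : volume E ≤ ∑' y, volume.restrict (cubeAt N y) E := by
    calc volume E ≤ volume (⋃ y, E ∩ cubeAt N y) := by
          refine measure_mono_ae ?_
          filter_upwards [ae_mem_iUnion_cubeAt N] with x ⟨y, hy⟩ hx
          exact mem_iUnion.2 ⟨y, hx, hy⟩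
      _ ≤ _ := (measure_iUnion_le _).trans_eq
          (tsum_congr fun y => (Measure.restrict_apply' (measurableSet_cubeAt N y)).symm)
  have hy1 : ∀ y, volume.restrict (cubeAt N y) E ≤ S / ENNReal.ofReal l := fun y =>
    (measure_mono hEsub).trans ((meas_ge_le_lintegral_div hu.enorm.aemeasurable hl'
      ENNReal.ofReal_ne_top).trans (ENNReal.div_le_div_right (hS y) _))
  have hy2 : ∀ y, volume.restrict (cubeAt N y) E ^ (1 / p) ≤
      (∫⁻ x in cubeAt N y, ‖u x‖ₑ ^ p) ^ (1 / p) / ENNReal.ofReal l := fun y => by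
    have h : volume.restrict (cubeAt N y) E ≤
        (∫⁻ x in cubeAt N y, ‖u x‖ₑ ^ p) / ENNReal.ofReal l ^ p :=
      (measure_mono fun x hx => ENNReal.rpow_le_rpow (hEsub x hx) hp.le).trans
        (meas_ge_le_lintegral_div (hu.enorm.pow_const p).aemeasurable
          (by simp [hl]) (by simp [hp.le]))
    refine (ENNReal.rpow_le_rpow h (by positivity)).trans_eq ?_
    rw [ENNReal.div_rpow_of_nonneg _ _ (by positivity), ← ENNReal.rpow_mul,
      mul_one_div_cancel hp.ne', ENNReal.rpow_one]
  have ha : q / p = (q - 1) / p + 1 / p := by ring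
  have hq0 : 0 ≤ (q - 1) / p := div_nonneg (by linarith) hp.le
  calc volume E ^ (q / p) ≤ (∑' y, volume.restrict (cubeAt N y) E) ^ (q / p) :=
        ENNReal.rpow_le_rpow hcover (by positivity)
    _ ≤ ∑' y, volume.restrict (cubeAt N y) E ^ (q / p) :=
        ENNReal_rpow_tsum_le _ (by positivity) ((div_le_one hp).2 hqp)
    _ ≤ ∑' y, (S / ENNReal.ofReal l) ^ ((q - 1) / p) *
          ((∫⁻ x in cubeAt N y, ‖u x‖ₑ ^ p) ^ (1 / p) / ENNReal.ofReal l) := by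
        refine ENNReal.tsum_le_tsum fun y => ?_
        rw [ha, ENNReal.rpow_add_of_nonneg _ _ hq0 (by positivity)]
        exact mul_le_mul' (ENNReal.rpow_le_rpow (hy1 y) hq0) (hy2 y)
    _ = _ := by simp_rw [div_eq_mul_inv, ENNReal.tsum_mul_left, ENNReal.tsum_mul_right]

/-- The lattice point `y ∈ ℤ^N` as a vector of `ℝ^N`. -/
def latticePoint (N : ℕ) (y : Fin N → ℤ) : Euc N := WithLp.toLp 2 fun i => (y i : ℝ)

theorem cubeAt_subset_closedBall (N : ℕ) (y : Fin N → ℤ) :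
    cubeAt N y ⊆ Metric.closedBall (latticePoint N y) N := by
  intro x hx
  rw [mem_closedBall_iff_norm, EuclideanSpace.norm_eq]
  refine Real.sqrt_le_iff.2 ⟨by positivity, ?_⟩
  calc ∑ i, ‖(x - latticePoint N y) i‖ ^ 2 ≤ ∑ _i : Fin N, (1 : ℝ) := by
        refine Finset.sum_le_sum fun i _ => ?_
        have h := hx i
        have h1 : ‖(x - latticePoint N y) i‖ ≤ 1 := by
          rw [PiLp.sub_apply, latticePoint, Real.norm_eq_abs, abs_of_pos h.1]
          exact h.2.le
        exact pow_le_one₀ (norm_nonneg _) h1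
    _ = N := by simp
    _ ≤ (N : ℝ) ^ 2 := by exact_mod_cast Nat.le_self_pow two_ne_zero N

/-- Balls of fixed radius around lattice points have bounded overlap. -/
theorem exists_tsum_indicator_closedBall_le (N R : ℕ) : ∃ K : ℕ, ∀ x : Euc N,
    ∑' y, (Metric.closedBall (latticePoint N y) R).indicator (fun _ => (1 : ℝ≥0∞)) x ≤ K := by
  refine ⟨(2 * R + 2) ^ N, fun x => ?_⟩
  set s : Finset (Fin N → ℤ) := Fintype.piFinset fun i => Finset.Icc (⌊x i⌋ - R) (⌊x i⌋ + R + 1)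
  have hs : ∀ y ∉ s, (Metric.closedBall (latticePoint N y) R).indicator
      (fun _ => (1 : ℝ≥0∞)) x = 0 := by
    intro y hy
    refine indicator_of_notMem (fun hx => hy ?_) _
    refine Fintype.mem_piFinset.2 fun i => Finset.mem_Icc.2 ?_
    rw [mem_closedBall_iff_norm] at hx
    have h := (PiLp.norm_apply_le (x - latticePoint N y) i).trans hx
    rw [PiLp.sub_apply, latticePoint, Real.norm_eq_abs, abs_le] at h
    have h1 := Int.floor_le (x i)
    have h2 := Int.lt_floor_add_one (x i)
    constructor
    · have : ((⌊x i⌋ - R : ℤ) : ℝ) ≤ (y i : ℝ) := by push_cast; linarith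
      exact_mod_cast this
    · have : (y i : ℝ) ≤ ((⌊x i⌋ + R + 1 : ℤ) : ℝ) := by push_cast; linarith
      exact_mod_cast this
  rw [tsum_eq_sum hs]
  calc _ ≤ ∑ _y ∈ s, (1 : ℝ≥0∞) := Finset.sum_le_sum fun y _ => indicator_le_self' (by simp) x
    _ = (s.card : ℝ≥0∞) := by simp
    _ ≤ _ := by
      have : s.card = (2 * R + 2) ^ N := by
        simp only [s, Fintype.card_piFinset, Int.card_Icc]
        rw [Finset.prod_congr rfl (g := fun _ => 2 * R + 2) fun i _ => by omega]
        simp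
      rw [this]

theorem holderConjugate_finrank {N : ℕ} (hN : 2 ≤ N) :
    Real.HolderConjugate (Module.finrank ℝ (Euc N)) ((N : ℝ) / ((N : ℝ) - 1)) := by
  rw [finrank_euclideanSpace_fin]
  exact Real.HolderConjugate.conjExponent (by exact_mod_cast hN)

/-- Local Sobolev inequality on a unit cube, with the right-hand side on a larger ball. -/
theorem exists_sobolev_cube {N : ℕ} (hN : 2 ≤ N) {p : ℝ} (hp : p = (N : ℝ) / ((N : ℝ) - 1)) :
    ∃ C : NNReal, ∀ v : Euc N → ℝ, ContDiff ℝ 1 v → ∀ y,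
      (∫⁻ x in cubeAt N y, ‖v x‖ₑ ^ p) ^ (1 / p) ≤ C * ∫⁻ x,
        (Metric.closedBall (latticePoint N y) (N + 1 : ℕ)).indicator (fun _ => (1 : ℝ≥0∞)) x *
          (‖fderiv ℝ v x‖ₑ + ‖v x‖ₑ) := by
  have hconj := holderConjugate_finrank hN
  rw [← hp] at hconj
  have hp0 : 0 < p := hconj.symm.pos
  have hN0 : (0 : ℝ) < N := by exact_mod_cast (by omega : 0 < N)
  let φ : ContDiffBump (0 : Euc N) := ⟨N, N + 1, hN0, by linarith⟩
  obtain ⟨B, hB⟩ := (φ.hasCompactSupport.fderiv ℝ).exists_bound_of_continuous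
    ((φ.contDiff (n := 1)).continuous_fderiv one_ne_zero)
  set C₀ := lintegralPowLePowLIntegralFDerivConst (volume : Measure (Euc N)) p
  refine ⟨C₀ ^ (1 / p) * (1 + B.toNNReal), fun v hv y => ?_⟩
  set c := latticePoint N y
  set I := (Metric.closedBall c (N + 1 : ℕ)).indicator (fun _ => (1 : ℝ≥0∞))
  set φy : Euc N → ℝ := fun x => φ (x - c) with hφy
  have hφyd : ContDiff ℝ 1 φy := φ.contDiff.comp (contDiff_id.sub contDiff_const)
  have hφyc : HasCompactSupport φy := by
    simpa [hφy, sub_eq_add_neg, Function.comp_def] using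
      φ.hasCompactSupport.comp_homeomorph (Homeomorph.addRight (-c))
  have hφyB : ∀ x, ‖fderiv ℝ φy x‖ ≤ B := fun x => by
    rw [hφy, fderiv_comp_sub]
    exact hB _
  have htsupp : tsupport φy ⊆ Metric.closedBall c (N + 1 : ℕ) := by
    refine closure_minimal (fun x hx => ?_) Metric.isClosed_closedBall
    have : x - c ∈ Function.support φ := hx
    rw [φ.support_eq, mem_ball_zero_iff] at this
    rw [mem_closedBall_iff_norm]
    push_cast
    exact this.le
  have hφone : ∀ x ∈ cubeAt N y, φy x = 1 := fun x hx => by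
    refine φ.one_of_mem_closedBall ?_
    rw [mem_closedBall_zero_iff, ← mem_closedBall_iff_norm]
    exact cubeAt_subset_closedBall N y hx
  have hderiv : ∀ x, ‖fderiv ℝ (fun x => φy x * v x) x‖ₑ ≤
      (1 + B.toNNReal : NNReal) * (I x * (‖fderiv ℝ v x‖ₑ + ‖v x‖ₑ)) := by
    intro x
    by_cases hx : x ∈ Metric.closedBall c (N + 1 : ℕ)
    · have h1 : I x = 1 := indicator_of_mem hx _
      rw [h1, one_mul, fderiv_fun_mul (hφyd.differentiable one_ne_zero x)
        (hv.differentiable one_ne_zero x)]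
      refine (enorm_add_le (φy x • fderiv ℝ v x) (v x • fderiv ℝ φy x)).trans ?_
      rw [enorm_smul, enorm_smul]
      have h2 : ‖φy x‖ₑ ≤ 1 := by
        rw [Real.enorm_eq_ofReal φ.nonneg]
        exact ENNReal.ofReal_le_one.2 φ.le_one
      have h3 : ‖fderiv ℝ φy x‖ₑ ≤ B.toNNReal := by
        rw [← ofReal_norm]
        exact ENNReal.ofReal_le_ofReal (hφyB x)
      calc _ ≤ 1 * ‖fderiv ℝ v x‖ₑ + ‖v x‖ₑ * B.toNNReal := by gcongr
        _ ≤ (1 * ‖fderiv ℝ v x‖ₑ + ‖v x‖ₑ * B.toNNReal) +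
            (B.toNNReal * ‖fderiv ℝ v x‖ₑ + ‖v x‖ₑ) := le_self_add
        _ = _ := by push_cast; ring
    · have h1 : fderiv ℝ (fun x => φy x * v x) x = 0 := by
        refine image_eq_zero_of_notMem_tsupport fun h => hx (htsupp ?_)
        exact (tsupport_mul_subset_left (f := φy) (g := v)) (tsupport_fderiv_subset ℝ h)
      rw [h1, ← ofReal_norm, norm_zero, ENNReal.ofReal_zero]
      exact zero_le
  have hp1 : (0 : ℝ) ≤ 1 / p := by positivity
  calc (∫⁻ x in cubeAt N y, ‖v x‖ₑ ^ p) ^ (1 / p)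
      ≤ (∫⁻ x, ‖φy x * v x‖ₑ ^ p) ^ (1 / p) := by
        refine ENNReal.rpow_le_rpow ?_ hp1
        refine le_trans (setLIntegral_mono' (measurableSet_cubeAt N y) fun x hx => ?_)
          (setLIntegral_le_lintegral (cubeAt N y) _)
        rw [hφone x hx, one_mul]
    _ ≤ (C₀ * (∫⁻ x, ‖fderiv ℝ (fun x => φy x * v x) x‖ₑ) ^ p) ^ (1 / p) :=
        ENNReal.rpow_le_rpow (lintegral_pow_le_pow_lintegral_fderiv volume (hφyd.mul hv)
          hφyc.mul_right hconj) hp1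
    _ = (C₀ : ℝ≥0∞) ^ (1 / p) * ∫⁻ x, ‖fderiv ℝ (fun x => φy x * v x) x‖ₑ := by
        rw [ENNReal.mul_rpow_of_nonneg _ _ hp1, ← ENNReal.rpow_mul, mul_one_div_cancel hp0.ne',
          ENNReal.rpow_one]
    _ ≤ (C₀ : ℝ≥0∞) ^ (1 / p) * ∫⁻ x,
          (1 + B.toNNReal : NNReal) * (I x * (‖fderiv ℝ v x‖ₑ + ‖v x‖ₑ)) := by
        gcongr with x
        exact hderiv x
    _ = _ := by
        rw [lintegral_const_mul' _ _ ENNReal.coe_ne_top, ← mul_assoc, ENNReal.coe_mul,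
          ENNReal.coe_rpow_of_nonneg _ hp1]

/-- Sobolev inequality summed over all unit lattice cubes, for smooth functions. -/
theorem exists_sobolev_cubes_smooth {N : ℕ} (hN : 2 ≤ N) {p : ℝ}
    (hp : p = (N : ℝ) / ((N : ℝ) - 1)) :
    ∃ C : NNReal, ∀ v : Euc N → ℝ, ContDiff ℝ 1 v →
      ∑' y, (∫⁻ x in cubeAt N y, ‖v x‖ₑ ^ p) ^ (1 / p) ≤
        C * ((∫⁻ x, ‖fderiv ℝ v x‖ₑ) + ∫⁻ x, ‖v x‖ₑ) := by
  obtain ⟨C, hC⟩ := exists_sobolev_cube hN hp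
  obtain ⟨K, hK⟩ := exists_tsum_indicator_closedBall_le N (N + 1)
  refine ⟨C * K, fun v hv => ?_⟩
  have hm : Measurable fun x => ‖fderiv ℝ v x‖ₑ :=
    (hv.continuous_fderiv one_ne_zero).enorm.measurable
  have hm' : Measurable fun x => ‖fderiv ℝ v x‖ₑ + ‖v x‖ₑ := hm.add hv.continuous.enorm.measurable
  calc _ ≤ ∑' y, C * ∫⁻ x,
        (Metric.closedBall (latticePoint N y) (N + 1 : ℕ)).indicator (fun _ => (1 : ℝ≥0∞)) x *
          (‖fderiv ℝ v x‖ₑ + ‖v x‖ₑ) := ENNReal.tsum_le_tsum (hC v hv)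
    _ = C * ∫⁻ x, (∑' y, (Metric.closedBall (latticePoint N y) (N + 1 : ℕ)).indicator
          (fun _ => (1 : ℝ≥0∞)) x) * (‖fderiv ℝ v x‖ₑ + ‖v x‖ₑ) := by
        simp_rw [← ENNReal.tsum_mul_right]
        rw [ENNReal.tsum_mul_left, lintegral_tsum]
        exact fun y => ((measurable_const.indicator Metric.isClosed_closedBall.measurableSet).mul
          hm').aemeasurable
    _ ≤ C * ∫⁻ x, K * (‖fderiv ℝ v x‖ₑ + ‖v x‖ₑ) := by
        gcongr with x
        exact hK x
    _ = _ := by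
        rw [lintegral_const_mul _ hm', lintegral_add_left hm]
        push_cast
        ring

theorem ofReal_integral_mul_fderiv_le_TV {N : ℕ} (u : Euc N → ℝ) (i : Fin N) {ψ : Euc N → ℝ}
    (hψ : ContDiff ℝ (⊤ : ℕ∞) ψ) (hψc : HasCompactSupport ψ) (hψ1 : ∀ x, |ψ x| ≤ 1) :
    ENNReal.ofReal (∫ x, u x * fderiv ℝ ψ x (EuclideanSpace.single i 1)) ≤ TV N u univ := by
  have hd : ∀ x, fderiv ℝ ψ x (EuclideanSpace.single i 1) =
      divg N (fun x => ψ x • EuclideanSpace.single i (1 : ℝ)) x := by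
    intro x
    have hf : fderiv ℝ (fun x => ψ x • EuclideanSpace.single i (1 : ℝ)) x =
        (fderiv ℝ ψ x).smulRight (EuclideanSpace.single i (1 : ℝ)) :=
      ((hψ.differentiable (by simp) x).hasFDerivAt.smul_const _).fderiv
    rw [divg, hf, Finset.sum_eq_single i]
    · simp
    · intro j _ hj
      simp [hj]
    · simp
  simp_rw [hd]
  refine le_iSup_of_le (fun x => ψ x • EuclideanSpace.single i (1 : ℝ)) ?_
  refine le_iSup_of_le (hψ.smul contDiff_const) (le_iSup_of_le hψc.smul_right ?_)
  refine le_iSup_of_le (fun x => ?_) (le_iSup_of_le (subset_univ _) le_rfl)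
  simpa [norm_smul] using hψ1 x

/-- The `L¹` norm of a smooth function is attained by duality against smooth test functions. -/
theorem lintegral_enorm_le_of_test {N : ℕ} {g : Euc N → ℝ} (hg : ContDiff ℝ (⊤ : ℕ∞) g)
    {T : ℝ≥0∞} (hT : ∀ ψ : Euc N → ℝ, ContDiff ℝ (⊤ : ℕ∞) ψ → HasCompactSupport ψ →
      (∀ x, |ψ x| ≤ 1) → ENNReal.ofReal (∫ x, g x * ψ x) ≤ T) :
    ∫⁻ x, ‖g x‖ₑ ≤ T := by
  let χ : ℕ → ContDiffBump (0 : Euc N) := fun n =>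
    ⟨n + 1, n + 2, by positivity, by linarith⟩
  let s : ℕ → Euc N → ℝ := fun n x => √(g x ^ 2 + 1 / ((n : ℝ) + 1))
  have hpos : ∀ (n : ℕ) (x : Euc N), 0 < g x ^ 2 + 1 / ((n : ℝ) + 1) := fun n x =>
    add_pos_of_nonneg_of_pos (sq_nonneg _) (by positivity)
  have hs0 : ∀ n x, 0 < s n x := fun n x => Real.sqrt_pos.2 (hpos n x)
  let ψ : ℕ → Euc N → ℝ := fun n x => χ n x * (g x / s n x)
  have hsd : ∀ n, ContDiff ℝ (⊤ : ℕ∞) (s n) := fun n =>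
    ((hg.pow 2).add contDiff_const).sqrt fun x => (hpos n x).ne'
  have hψd : ∀ n, ContDiff ℝ (⊤ : ℕ∞) (ψ n) := fun n =>
    (χ n).contDiff.mul (hg.div (hsd n) fun x => (hs0 n x).ne')
  have hψc : ∀ n, HasCompactSupport (ψ n) := fun n => (χ n).hasCompactSupport.mul_right
  have hψ1 : ∀ n x, |ψ n x| ≤ 1 := fun n x => by
    rw [abs_mul, abs_of_nonneg (χ n).nonneg, abs_div, abs_of_pos (hs0 n x)]
    refine mul_le_one₀ (χ n).le_one (div_nonneg (abs_nonneg _) (hs0 n x).le) ?_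
    rw [div_le_one (hs0 n x)]
    refine Real.le_sqrt_of_sq_le ?_
    rw [sq_abs]
    have : 0 < 1 / ((n : ℝ) + 1) := by positivity
    linarith
  have hnn : ∀ n x, 0 ≤ g x * ψ n x := fun n x => by
    have h : g x * ψ n x = χ n x * (g x ^ 2 / s n x) := by simp only [ψ]; ring
    rw [h]
    exact mul_nonneg (χ n).nonneg (div_nonneg (sq_nonneg _) (hs0 n x).le)
  have hcont : ∀ n, Continuous fun x => g x * ψ n x := fun n =>
    hg.continuous.mul (hψd n).continuous
  have hle : ∀ n, ∫⁻ x, ENNReal.ofReal (g x * ψ n x) ≤ T := fun n => by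
    rw [← ofReal_integral_eq_lintegral_ofReal
      ((hcont n).integrable_of_hasCompactSupport (hψc n).mul_left)
      (Eventually.of_forall (hnn n))]
    exact hT _ (hψd n) (hψc n) (hψ1 n)
  have hlim : ∀ x, Tendsto (fun n => ENNReal.ofReal (g x * ψ n x)) atTop (𝓝 ‖g x‖ₑ) := by
    intro x
    rw [Real.enorm_eq_ofReal_abs]
    refine ENNReal.tendsto_ofReal ?_
    have hs : Tendsto (fun n => s n x) atTop (𝓝 |g x|) := by
      have h := (tendsto_const_nhds (x := g x ^ 2)).add
        (tendsto_one_div_add_atTop_nhds_zero_nat (𝕜 := ℝ))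
      rw [add_zero] at h
      have h2 := h.sqrt
      rwa [Real.sqrt_sq_eq_abs] at h2
    have hq : Tendsto (fun n => g x * (g x / s n x)) atTop (𝓝 |g x|) := by
      by_cases h0 : g x = 0
      · simp [h0]
      · have h := (tendsto_const_nhds (x := g x)).mul
          ((tendsto_const_nhds (x := g x)).div hs (abs_ne_zero.2 h0))
        have he : g x * (g x / |g x|) = |g x| := by
          rw [← mul_div_assoc, ← abs_mul_abs_self, mul_div_assoc, div_self (abs_ne_zero.2 h0),
            mul_one]
        rwa [he] at h
    refine hq.congr' ?_
    filter_upwards [eventually_ge_atTop ⌈‖x‖⌉₊] with n hn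
    have h1 : χ n x = 1 := by
      refine (χ n).one_of_mem_closedBall ?_
      rw [mem_closedBall_zero_iff]
      have : ‖x‖ ≤ n := (Nat.le_ceil _).trans (by exact_mod_cast hn)
      change ‖x‖ ≤ (n : ℝ) + 1
      linarith
    simp only [ψ, h1, one_mul]
  calc ∫⁻ x, ‖g x‖ₑ = ∫⁻ x, liminf (fun n => ENNReal.ofReal (g x * ψ n x)) atTop :=
        lintegral_congr fun x => (hlim x).liminf_eq.symm
    _ ≤ liminf (fun n => ∫⁻ x, ENNReal.ofReal (g x * ψ n x)) atTop :=
        lintegral_liminf_le fun n => (hcont n).measurable.ennreal_ofReal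
    _ ≤ liminf (fun _ : ℕ => T) atTop := liminf_le_liminf (Eventually.of_forall hle)
    _ = T := by simp

open ContinuousLinearMap Convolution in
theorem integral_fderiv_mollify_mul_le_TV {N : ℕ} {u : Euc N → ℝ} (hu : Integrable u)
    (φ : ContDiffBump (0 : Euc N)) (i : Fin N) {ψ : Euc N → ℝ}
    (hψ : ContDiff ℝ (⊤ : ℕ∞) ψ) (hψc : HasCompactSupport ψ) (hψ1 : ∀ x, |ψ x| ≤ 1) :
    ENNReal.ofReal (∫ x, fderiv ℝ (φ.normed volume ⋆[lsmul ℝ ℝ, volume] u) x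
      (EuclideanSpace.single i 1) * ψ x) ≤ TV N u univ := by
  set e : Euc N := EuclideanSpace.single i 1
  set ρ := φ.normed (volume : Measure (Euc N)) with hρ
  set v := ρ ⋆[lsmul ℝ ℝ, volume] u with hv
  have hρc : HasCompactSupport ρ := φ.hasCompactSupport_normed
  have hρi : Integrable ρ := φ.integrable_normed
  have hvd : ContDiff ℝ 1 v :=
    hρc.contDiff_convolution_left (lsmul ℝ ℝ) (n := 1) φ.contDiff_normed hu.locallyIntegrable
  have hψd : ContDiff ℝ 1 ψ := hψ.of_le (by exact_mod_cast le_top)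
  set dψ : Euc N → ℝ := fun x => fderiv ℝ ψ x e with hψ'
  have hdψcont : Continuous dψ := (hψd.continuous_fderiv one_ne_zero).clm_apply continuous_const
  have hdψc : HasCompactSupport dψ := hψc.fderiv_apply ℝ e
  have hdvcont : Continuous fun x => fderiv ℝ v x e :=
    (hvd.continuous_fderiv one_ne_zero).clm_apply continuous_const
  have hparts : ∫ x, fderiv ℝ v x e * ψ x = -∫ x, v x * dψ x := by
    rw [hψ', integral_mul_fderiv_eq_neg_fderiv_mul_of_integrable, neg_neg]
    · exact (hdvcont.mul hψ.continuous).integrable_of_hasCompactSupport hψc.mul_left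
    · exact (hvd.continuous.mul hdψcont).integrable_of_hasCompactSupport hdψc.mul_left
    · exact (hvd.continuous.mul hψ.continuous).integrable_of_hasCompactSupport hψc.mul_left
    · exact fun x _ => hvd.differentiable one_ne_zero x
    · exact fun x _ => hψd.differentiable one_ne_zero x
  set w : Euc N → ℝ := fun x => -(ρ ⋆[lsmul ℝ ℝ, volume] ψ) x with hw
  have hwd : ContDiff ℝ (⊤ : ℕ∞) w :=
    (hψc.contDiff_convolution_right (lsmul ℝ ℝ) hρi.locallyIntegrable hψ).neg
  have hwc : HasCompactSupport w := (hρc.convolution (lsmul ℝ ℝ) hψc).neg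
  have hw1 : ∀ x, |w x| ≤ 1 := fun x => by
    rw [hw, abs_neg, ← Real.norm_eq_abs, convolution_def]
    calc ‖∫ t, lsmul ℝ ℝ (ρ t) (ψ (x - t))‖ ≤ ∫ t, ρ t := by
          refine norm_integral_le_of_norm_le hρi (Eventually.of_forall fun t => ?_)
          rw [lsmul_apply, norm_smul, Real.norm_of_nonneg (φ.nonneg_normed t)]
          exact mul_le_of_le_one_right (φ.nonneg_normed t) (hψ1 _)
      _ = 1 := φ.integral_normed
  have hwderiv : ∀ x, fderiv ℝ w x e = -(ρ ⋆[lsmul ℝ ℝ, volume] dψ) x := fun x => by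
    have h := (hψc.hasFDerivAt_convolution_right (lsmul ℝ ℝ) hρi.locallyIntegrable hψd x).neg
    rw [HasFDerivAt.fderiv (f := w) h, _root_.neg_apply,
      convolution_precompR_apply (lsmul ℝ ℝ) hρi.locallyIntegrable (hψc.fderiv ℝ)
        (hψd.continuous_fderiv one_ne_zero)]
  have hswap : ∫ x, v x * dψ x = ∫ t, u t * (ρ ⋆[lsmul ℝ ℝ, volume] dψ) t := by
    obtain ⟨B, hB⟩ := hdψc.exists_bound_of_continuous hdψcont
    have hint : Integrable (fun z : Euc N × Euc N => (u z.2 * ρ (z.1 - z.2)) * dψ z.1)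
        (volume.prod volume) := by
      refine (hu.convolution_integrand (lsmul ℝ ℝ) hρi).mul_bdd (c := B) ?_ ?_
      · exact (hdψcont.comp continuous_fst).aestronglyMeasurable
      · exact Eventually.of_forall fun z => hB z.1
    calc ∫ x, v x * dψ x = ∫ x, ∫ t, (u t * ρ (x - t)) * dψ x := by
          refine integral_congr_ae (Eventually.of_forall fun x => ?_)
          simp only [hv, convolution_lsmul_swap, smul_eq_mul, ← integral_mul_const]
          simp only [mul_comm]
      _ = ∫ t, ∫ x, (u t * ρ (x - t)) * dψ x := integral_integral_swap hint
      _ = _ := by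
          refine integral_congr_ae (Eventually.of_forall fun t => ?_)
          simp only [convolution_lsmul_swap, smul_eq_mul, ← integral_const_mul, mul_assoc]
          refine integral_congr_ae (Eventually.of_forall fun x => ?_)
          simp only [← φ.normed_neg (x - t), neg_sub, hρ]
  rw [hparts, hswap, ← integral_neg]
  convert ofReal_integral_mul_fderiv_le_TV u i hwd hwc hw1 using 4 with x
  rw [hwderiv, mul_neg]

open ContinuousLinearMap Convolution in
theorem lintegral_enorm_mollify_le {N : ℕ} {u : Euc N → ℝ} (hu : Measurable u)
    (φ : ContDiffBump (0 : Euc N)) :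
    ∫⁻ x, ‖(φ.normed volume ⋆[lsmul ℝ ℝ, volume] u) x‖ₑ ≤ ∫⁻ x, ‖u x‖ₑ := by
  set ρ := φ.normed (volume : Measure (Euc N)) with hρ
  have hρm : Measurable ρ := φ.continuous_normed.measurable
  have hρ1 : ∫⁻ t, ‖ρ t‖ₑ = 1 := by
    rw [← ENNReal.ofReal_one, ← φ.integral_normed (μ := volume),
      ofReal_integral_eq_lintegral_ofReal φ.integrable_normed
        (Eventually.of_forall φ.nonneg_normed)]
    exact lintegral_congr fun t => Real.enorm_eq_ofReal (φ.nonneg_normed t)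
  calc _ ≤ ∫⁻ x, ∫⁻ t, ‖ρ t‖ₑ * ‖u (x - t)‖ₑ := by
        refine lintegral_mono fun x => (enorm_integral_le_lintegral_enorm _).trans_eq ?_
        exact lintegral_congr fun t => by rw [lsmul_apply, enorm_smul]
    _ = ∫⁻ t, ∫⁻ x, ‖ρ t‖ₑ * ‖u (x - t)‖ₑ := by
        refine lintegral_lintegral_swap (Measurable.aemeasurable ?_)
        exact (hρm.comp measurable_snd).enorm.mul (hu.comp (measurable_fst.sub measurable_snd)).enorm
    _ = ∫⁻ t, ‖ρ t‖ₑ * ∫⁻ x, ‖u x‖ₑ := by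
        refine lintegral_congr fun t => ?_
        rw [lintegral_const_mul' _ _ enorm_ne_top,
          lintegral_sub_right_eq_self (fun x => ‖u x‖ₑ) t]
    _ = _ := by rw [lintegral_mul_const _ hρm.enorm, hρ1, one_mul]

theorem norm_le_sum_norm_apply_single {N : ℕ} (L : Euc N →L[ℝ] ℝ) :
    ‖L‖ ≤ ∑ i, ‖L (EuclideanSpace.single i 1)‖ := by
  refine L.opNorm_le_bound (Finset.sum_nonneg fun i _ => norm_nonneg _) fun x => ?_
  have hx : x = ∑ i, x i • EuclideanSpace.single i (1 : ℝ) := by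
    ext j
    simp [Pi.single_apply]
  calc ‖L x‖ = ‖∑ i, x i * L (EuclideanSpace.single i 1)‖ := by
        conv_lhs => rw [hx, map_sum]
        simp only [map_smul, smul_eq_mul]
    _ ≤ ∑ i, ‖x i * L (EuclideanSpace.single i 1)‖ := norm_sum_le _ _
    _ ≤ ∑ i, ‖L (EuclideanSpace.single i 1)‖ * ‖x‖ := Finset.sum_le_sum fun i _ => by
        rw [norm_mul, mul_comm]
        gcongr
        exact PiLp.norm_apply_le x i
    _ = _ := by rw [Finset.sum_mul]

open ContinuousLinearMap Convolution in
theorem lintegral_fderiv_mollify_le {N : ℕ} {u : Euc N → ℝ} (hu : Integrable u)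
    (φ : ContDiffBump (0 : Euc N)) :
    ∫⁻ x, ‖fderiv ℝ (φ.normed volume ⋆[lsmul ℝ ℝ, volume] u) x‖ₑ ≤ N * TV N u univ := by
  set v := φ.normed volume ⋆[lsmul ℝ ℝ, volume] u with hv
  have hvd : ContDiff ℝ (⊤ : ℕ∞) v :=
    φ.hasCompactSupport_normed.contDiff_convolution_left (lsmul ℝ ℝ) φ.contDiff_normed
      hu.locallyIntegrable
  have hd : ∀ i : Fin N, ContDiff ℝ (⊤ : ℕ∞) fun x => fderiv ℝ v x (EuclideanSpace.single i 1) :=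
    fun i => (hvd.fderiv_right (m := (⊤ : ℕ∞)) (by simp)).clm_apply contDiff_const
  calc _ ≤ ∫⁻ x, ∑ i, ‖fderiv ℝ v x (EuclideanSpace.single i 1)‖ₑ := by
        refine lintegral_mono fun x => ?_
        simp_rw [← ofReal_norm]
        rw [← ENNReal.ofReal_sum_of_nonneg fun i _ => norm_nonneg _]
        exact ENNReal.ofReal_le_ofReal (norm_le_sum_norm_apply_single _)
    _ = ∑ i, ∫⁻ x, ‖fderiv ℝ v x (EuclideanSpace.single i 1)‖ₑ :=
        lintegral_finsetSum _ fun i _ => (hd i).continuous.measurable.enorm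
    _ ≤ ∑ _i : Fin N, TV N u univ := Finset.sum_le_sum fun i _ =>
        lintegral_enorm_le_of_test (hd i) fun ψ h1 h2 h3 =>
          integral_fderiv_mollify_mul_le_TV hu φ i h1 h2 h3
    _ = _ := by simp

open ContinuousLinearMap Convolution in
/-- Sobolev inequality summed over all unit lattice cubes, for integrable `BV` functions. -/
theorem exists_sobolev_cubes {N : ℕ} (hN : 2 ≤ N) {p : ℝ} (hp : p = (N : ℝ) / ((N : ℝ) - 1)) :
    ∃ C : NNReal, ∀ u : Euc N → ℝ, Measurable u → Integrable u →
      ∑' y, (∫⁻ x in cubeAt N y, ‖u x‖ₑ ^ p) ^ (1 / p) ≤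
        C * (TV N u univ + ∫⁻ x, ‖u x‖ₑ) := by
  obtain ⟨C, hC⟩ := exists_sobolev_cubes_smooth hN hp
  have hp0 : 0 < p := hp ▸ (holderConjugate_finrank hN).symm.pos
  have hp1 : (0 : ℝ) ≤ 1 / p := by positivity
  refine ⟨C * N, fun u hum hu => ?_⟩
  let φ : ℕ → ContDiffBump (0 : Euc N) := fun n =>
    ⟨1 / ((n : ℝ) + 1), 2 * (1 / ((n : ℝ) + 1)), by positivity,
      by linarith [show 0 < 1 / ((n : ℝ) + 1) by positivity]⟩
  let v : ℕ → Euc N → ℝ := fun n => (φ n).normed volume ⋆[lsmul ℝ ℝ, volume] u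
  have hvd : ∀ n, ContDiff ℝ 1 (v n) := fun n =>
    (φ n).hasCompactSupport_normed.contDiff_convolution_left (lsmul ℝ ℝ) (n := 1)
      (φ n).contDiff_normed hu.locallyIntegrable
  have hlim : ∀ᵐ x, Tendsto (fun n => v n x) atTop (𝓝 (u x)) := by
    refine ContDiffBump.ae_convolution_tendsto_right_of_locallyIntegrable (K := 2) ?_
      (Eventually.of_forall fun n => le_rfl) hu.locallyIntegrable
    simpa [φ] using (tendsto_one_div_add_atTop_nhds_zero_nat (𝕜 := ℝ)).const_mul 2
  have hm : ∀ n, Measurable fun x => ‖v n x‖ₑ ^ p := fun n =>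
    (hvd n).continuous.measurable.enorm.pow_const p
  have hcube : ∀ y, (∫⁻ x in cubeAt N y, ‖u x‖ₑ ^ p) ^ (1 / p) ≤
      liminf (fun n => (∫⁻ x in cubeAt N y, ‖v n x‖ₑ ^ p) ^ (1 / p)) atTop := fun y => by
    have h : ∫⁻ x in cubeAt N y, ‖u x‖ₑ ^ p ≤
        liminf (fun n => ∫⁻ x in cubeAt N y, ‖v n x‖ₑ ^ p) atTop := by
      refine le_trans (le_of_eq (lintegral_congr_ae ?_)) (lintegral_liminf_le hm)
      filter_upwards [ae_restrict_of_ae hlim] with x hx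
      exact (((ENNReal.continuous_rpow_const (y := p)).tendsto _).comp hx.enorm).liminf_eq.symm
    refine (ENNReal.rpow_le_rpow h hp1).trans_eq ?_
    exact (ENNReal.monotone_rpow_of_nonneg hp1).map_liminf_of_continuousAt _
      ENNReal.continuous_rpow_const.continuousAt
  calc _ ≤ ∑' y, liminf (fun n => (∫⁻ x in cubeAt N y, ‖v n x‖ₑ ^ p) ^ (1 / p)) atTop :=
        ENNReal.tsum_le_tsum hcube
    _ ≤ liminf (fun n => ∑' y, (∫⁻ x in cubeAt N y, ‖v n x‖ₑ ^ p) ^ (1 / p)) atTop := by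
        simp_rw [← lintegral_count]
        exact lintegral_liminf_le fun n => measurable_of_countable _
    _ ≤ liminf (fun _ : ℕ => C * (N * TV N u univ + ∫⁻ x, ‖u x‖ₑ)) atTop := by
        refine liminf_le_liminf (Eventually.of_forall fun n => (hC _ (hvd n)).trans ?_)
        exact mul_le_mul_right (add_le_add (lintegral_fderiv_mollify_le hu (φ n))
          (lintegral_enorm_mollify_le hum (φ n))) _
    _ = C * (N * TV N u univ + ∫⁻ x, ‖u x‖ₑ) := by simp
    _ ≤ C * (N * TV N u univ + N * ∫⁻ x, ‖u x‖ₑ) := by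
        gcongr
        exact le_mul_of_one_le_left' (by exact_mod_cast (by omega : 1 ≤ N))
    _ = _ := by push_cast; ring

theorem setIntegral_cubeAt_le {N : ℕ} {u : Euc N → ℝ} {M : ℝ} (huM : ∀ᵐ x, |u x| ≤ M)
    (y : Fin N → ℤ) :
    ∫ x in cubeAt N y, |u x| ≤ M * volume.real (Metric.closedBall (0 : Euc N) N) := by
  have hM : 0 ≤ M := by
    obtain ⟨x, hx⟩ := huM.exists
    exact (abs_nonneg _).trans hx
  have hsub := cubeAt_subset_closedBall N y
  have hfin : volume (Metric.closedBall (latticePoint N y) (N : ℝ)) < ∞ := measure_closedBall_lt_top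
  have h := norm_setIntegral_le_of_norm_le_const_ae' (μ := volume) (s := cubeAt N y)
    (f := fun x => |u x|) (C := M) ((measure_mono hsub).trans_lt hfin)
    (by filter_upwards [huM] with x hx _ using by simpa using hx)
  refine (le_abs_self _).trans (h.trans (mul_le_mul_of_nonneg_left ?_ hM))
  refine (measureReal_mono hsub hfin.ne).trans_eq ?_
  simp only [measureReal_def, Measure.addHaar_closedBall_center]

/-- global version of the cube estimate: for `u ∈ BV̇(ℝ^N) ∩ L^1(ℝ^N)`
with `|u| ≤ M` a.e.,
`‖u‖_{L^{1*,q}}^q ≤ C (‖Du‖ + ‖u‖_{L^1}) (sup_{y∈ℤ^N} ∫_{y+(0,1)^N}|u|)^{(q-1)/3}`. -/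
theorem global_lorentz_estimate
    (N : ℕ) (hN : 2 ≤ N) (q : ℝ) (hq1 : 1 < q) (hq2 : q ≤ (N : ℝ) / ((N : ℝ) - 1))
    (M : ℝ) (hM : 0 < M) :
    ∃ C : ℝ, 0 < C ∧ ∀ u : Euc N → ℝ,
      MemBVdot N u → Integrable u →
      (∀ᵐ x : Euc N, |u x| ≤ M) →
      lorentz N ((N : ℝ) / ((N : ℝ) - 1)) (ENNReal.ofReal q) u ^ q
        ≤ ENNReal.ofReal C * (TV N u univ + ENNReal.ofReal (∫ x, |u x|))
          * ENNReal.ofReal ((⨆ y : Fin N → ℤ, ∫ x in cubeAt N y, |u x|) ^ ((q - 1) / 3)) := by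
  set p : ℝ := (N : ℝ) / ((N : ℝ) - 1) with hp
  have hN2 : (2 : ℝ) ≤ N := by exact_mod_cast hN
  have hp1 : 1 < p := (one_lt_div (by linarith)).2 (by linarith)
  have hp3 : p ≤ 3 := (div_le_iff₀ (by linarith)).2 (by linarith)
  have hp0 : 0 < p := by linarith
  have hq0 : 0 < q := by linarith
  have hq1' : 0 < q - 1 := by linarith
  set b : ℝ := (q - 1) / p with hb
  have hb0 : 0 < b := by positivity
  have hbq : b + 1 < q := by
    have : b < q - 1 := div_lt_self hq1' hp1
    linarith
  have hr : 0 < b + 1 := by linarith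
  set c₁ : ℝ := M ^ q / (q / p) + 1 / (q / p * (q / (b + 1) - 1))
  have hc₁0 : 0 < c₁ := by
    have h1 : 0 < q / (b + 1) - 1 := sub_pos.2 ((one_lt_div hr).2 hbq)
    positivity
  obtain ⟨c₂, hc₂⟩ := exists_sobolev_cubes hN hp
  set R : ℝ := M * volume.real (Metric.closedBall (0 : Euc N) N)
  have hR0 : 0 ≤ R := by positivity
  have hexp : 0 ≤ b - (q - 1) / 3 := sub_nonneg.2 (by rw [hb]; gcongr)
  refine ⟨c₁ * R ^ (b - (q - 1) / 3) * c₂ + 1, by positivity, fun u hu hui huM => ?_⟩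
  obtain ⟨hum, -, hTV⟩ := hu
  set S : ℝ := ⨆ y : Fin N → ℤ, ∫ x in cubeAt N y, |u x|
  have hle : ∀ y, ∫ x in cubeAt N y, |u x| ≤ S :=
    le_ciSup ⟨R, forall_mem_range.2 (setIntegral_cubeAt_le huM)⟩
  have hS0 : 0 ≤ S := (integral_nonneg fun x => abs_nonneg _).trans (hle 0)
  have hSR : S ≤ R := ciSup_le (setIntegral_cubeAt_le huM)
  have hS : ∀ y, ∫⁻ x in cubeAt N y, ‖u x‖ₑ ≤ ENNReal.ofReal S := fun y => by
    rw [← ofReal_integral_norm_eq_lintegral_enorm hui.integrableOn]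
    exact ENNReal.ofReal_le_ofReal (hle y)
  have hL1 : ∫⁻ x, ‖u x‖ₑ = ENNReal.ofReal (∫ x, |u x|) :=
    (ofReal_integral_norm_eq_lintegral_enorm hui).symm
  have hsob := hc₂ u hum hui
  rw [hL1] at hsob
  obtain ⟨T, hT⟩ : ∃ T : NNReal, TV N u univ + ENNReal.ofReal (∫ x, |u x|) = T :=
    ⟨_, (ENNReal.coe_toNNReal (ENNReal.add_lt_top.2 ⟨hTV, ENNReal.ofReal_lt_top⟩).ne).symm⟩
  rw [hT, ← ENNReal.coe_mul, ← ENNReal.ofReal_coe_nnreal, NNReal.coe_mul] at hsob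
  have hK : 0 ≤ S ^ b * (c₂ * T) := by positivity
  refine (lorentz_rpow_le (r := b + 1) hp0 hq0 hr hbq hK hM huM fun l hl => ?_).trans ?_
  · calc _ ≤ (ENNReal.ofReal S / ENNReal.ofReal l) ^ b *
          ((∑' y, (∫⁻ x in cubeAt N y, ‖u x‖ₑ ^ p) ^ (1 / p)) / ENNReal.ofReal l) :=
          volume_rpow_le_of_cubes hum hp0 hq1 hq2 hS hl
      _ ≤ (ENNReal.ofReal S / ENNReal.ofReal l) ^ b *
          (ENNReal.ofReal (c₂ * T) / ENNReal.ofReal l) := by gcongr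
      _ = _ := by
          rw [← ENNReal.ofReal_div_of_pos hl, ← ENNReal.ofReal_div_of_pos hl,
            ENNReal.ofReal_rpow_of_nonneg (by positivity) hb0.le,
            ← ENNReal.ofReal_mul (by positivity), Real.div_rpow hS0 hl.le, neg_add,
            Real.rpow_add hl, Real.rpow_neg hl.le, Real.rpow_neg_one]
          congr 1
          ring
  · rw [hT, ← ENNReal.ofReal_coe_nnreal, ← ENNReal.ofReal_mul (by positivity),
      ← ENNReal.ofReal_mul (by positivity)]
    refine ENNReal.ofReal_le_ofReal ?_
    have hSb : S ^ b ≤ R ^ (b - (q - 1) / 3) * S ^ ((q - 1) / 3) := by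
      calc S ^ b = S ^ (b - (q - 1) / 3) * S ^ ((q - 1) / 3) := by
            rw [← Real.rpow_add_of_nonneg hS0 hexp (by positivity), sub_add_cancel]
        _ ≤ _ := by gcongr
    have hTS : 0 ≤ (T : ℝ) * S ^ ((q - 1) / 3) := by positivity
    calc c₁ * (S ^ b * (c₂ * T))
        ≤ c₁ * ((R ^ (b - (q - 1) / 3) * S ^ ((q - 1) / 3)) * (c₂ * T)) := by gcongr
      _ ≤ c₁ * ((R ^ (b - (q - 1) / 3) * S ^ ((q - 1) / 3)) * (c₂ * T)) +
          T * S ^ ((q - 1) / 3) := le_add_of_nonneg_right hTS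
      _ = _ := by ring
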